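/- There is no polynomial f ∈ ℂ[x,t] with deg_x f ≥ 5 satisfying the generalized bilinear KdV-type equation; equivalently, every f ∈ ℂ[x,t] with 2 f_{xt} f − 2 f_t f_x + 6 (f_{xx})² = 0 has deg_x f ≤ 4. -/

import Mathlib

open Polynomial

/-- Formal partial derivative with respect to `t` on `ℂ[t][x]`
(outer variable `x`, inner variable `t`). -/
noncomputable def dt (f : Polynomial (Polynomial ℂ)) : Polynomial (Polynomial ℂ) :=
  f.sum fun n a => Polynomial.C (Polynomial.derivative a) * Polynomial.X ^ n

/-- Formal partial derivative with respect to `x` on `ℂ[t][x]`. -/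
noncomputable def dx (f : Polynomial (Polynomial ℂ)) : Polynomial (Polynomial ℂ) :=
  Polynomial.derivative f

/-- The operator `T f = 2 f_{xt} f − 2 f_t f_x + 6 (f_{xx})²`; the generalized bilinear
KdV-type equation is `T f = 0`. -/
noncomputable def Tkdv (f : Polynomial (Polynomial ℂ)) : Polynomial (Polynomial ℂ) :=
  2 * dx (dt f) * f - 2 * dt f * dx f + 6 * (dx (dx f)) ^ 2

theorem exists_greatest_of_bound {p : ℕ → Prop} {N : ℕ} (h : ∃ i, p i) (hN : ∀ i, p i → i ≤ N) :
    ∃ i, p i ∧ ∀ k, p k → k ≤ i := by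
  have hb : BddAbove {i | p i} := ⟨N, fun i hi => hN i hi⟩
  exact ⟨sSup {i | p i}, Nat.sSup_mem h hb, fun k hk => le_csSup hb hk⟩

theorem mem_antidiagonal_product {a k b l P Q : ℕ} (h : a + k = P) (h' : b + l = Q) :
    ((a, k), (b, l)) ∈ Finset.HasAntidiagonal.antidiagonal P ×ˢ
      Finset.HasAntidiagonal.antidiagonal Q := by
  simp [h, h']

/-- Coefficientwise form of the equation `f_{xt} f - f_t f_x + 3 (f_{xx})² = 0`, where `A i j` is
the coefficient of `x ^ i * t ^ j`. -/
def CoeffEquation (A : ℕ → ℕ → ℂ) : Prop :=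
  ∀ P Q : ℕ,
    ∑ x ∈ Finset.HasAntidiagonal.antidiagonal P ×ˢ Finset.HasAntidiagonal.antidiagonal (Q + 1),
        ((x.1.1 : ℂ) - x.1.2) * x.2.1 * (A x.1.1 x.2.1 * A x.1.2 x.2.2) +
      3 * ∑ x ∈ Finset.HasAntidiagonal.antidiagonal (P + 3) ×ˢ Finset.HasAntidiagonal.antidiagonal Q,
        ((x.1.1 : ℂ) * (x.1.1 - 1)) * (x.1.2 * (x.1.2 - 1)) *
          (A x.1.1 x.2.1 * A x.1.2 x.2.2) = 0

theorem coeff_dt (f : Polynomial (Polynomial ℂ)) (n : ℕ) :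
    (dt f).coeff n = derivative (f.coeff n) := by
  unfold dt
  rw [Polynomial.sum_def, Polynomial.finsetSum_coeff]
  simp only [coeff_C_mul, coeff_X_pow, mul_ite, mul_one, mul_zero]
  rw [Finset.sum_ite_eq]
  split_ifs with h
  · rfl
  · rw [notMem_support_iff.mp h, derivative_zero]

theorem coeff_X_mul_derivative {R : Type*} [CommRing R] (g : R[X]) (n : ℕ) :
    (X * derivative g).coeff n = n * g.coeff n := by
  cases n with
  | zero => simp
  | succ n => rw [coeff_X_mul, coeff_derivative]; push_cast; ring

theorem coeff_X_sq_mul_derivative_derivative {R : Type*} [CommRing R] (g : R[X]) (n : ℕ) :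
    (X ^ 2 * derivative (derivative g)).coeff n = (n * (n - 1)) * g.coeff n := by
  have h : X ^ 2 * derivative (derivative g) =
      X * derivative (X * derivative g) - X * derivative g := by
    simp only [derivative_mul, derivative_X]; ring
  rw [h, coeff_sub, coeff_X_mul_derivative, coeff_X_mul_derivative]
  ring

theorem coeffEquation_of_Tkdv_eq_zero {f : Polynomial (Polynomial ℂ)} (hf : Tkdv f = 0) :
    CoeffEquation fun i j => (f.coeff i).coeff j := by
  intro P Q
  have h1 : X ^ 3 * ((X * derivative (dt f)) * f - dt f * (X * derivative f)) +
      3 * (X ^ 2 * derivative (derivative f)) ^ 2 = 0 := by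
    have h2 : (2 : Polynomial (Polynomial ℂ)) ≠ 0 := two_ne_zero
    apply mul_left_cancel₀ h2
    unfold Tkdv dx at hf
    linear_combination X ^ 4 * hf
  have h3 : ∑ x ∈ Finset.HasAntidiagonal.antidiagonal P,
        ((x.1 : ℂ[X]) - (x.2 : ℂ[X])) * ((X * derivative (f.coeff x.1)) * f.coeff x.2) +
      3 * (X * ∑ x ∈ Finset.HasAntidiagonal.antidiagonal (P + 3),
        ((x.1 : ℂ[X]) * ((x.1 : ℂ[X]) - 1)) * ((x.2 : ℂ[X]) * ((x.2 : ℂ[X]) - 1))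
          * (f.coeff x.1 * f.coeff x.2)) = 0 := by
    have h4 := congrArg (fun g => X * g.coeff (P + 3)) h1
    have h5 : (3 : Polynomial (Polynomial ℂ)) = C 3 := (map_ofNat C 3).symm
    simp only [h5, sq (X ^ 2 * _), coeff_add, coeff_X_pow_mul, coeff_sub, coeff_C_mul] at h4
    simp only [coeff_mul (X * derivative (dt f)), coeff_mul (dt f), coeff_mul (X ^ 2 * _)] at h4
    simp only [coeff_X_mul_derivative, coeff_X_sq_mul_derivative_derivative, coeff_dt,
      ← Finset.sum_sub_distrib, coeff_zero, mul_zero] at h4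
    refine Eq.trans ?_ h4
    rw [mul_add, mul_left_comm X 3]
    refine congrArg₂ (· + ·)
      ((Finset.sum_congr rfl fun x _ => ?_).trans (Finset.mul_sum _ _ _).symm)
      (congrArg (3 * ·) (congrArg (X * ·) (Finset.sum_congr rfl fun x _ => ?_)))
    · ring
    · ring
  have h6 := congrArg (fun g => g.coeff (Q + 1)) h3
  have h7 : (3 : ℂ[X]) = C 3 := (map_ofNat C 3).symm
  have h8 : ∀ a b : ℕ, ((a : ℂ[X]) - b) = C ((a : ℂ) - b) := fun a b => by simp
  have h9 : ∀ a b : ℕ, ((a : ℂ[X]) * (a - 1)) * (b * (b - 1)) =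
    C (((a : ℂ) * (a - 1)) * (b * (b - 1))) := fun a b => by simp
  simp only [h7, h8, h9, coeff_add, coeff_C_mul, coeff_X_mul, finsetSum_coeff] at h6
  simp only [coeff_mul (X * derivative _), coeff_mul (f.coeff _), coeff_X_mul_derivative,
    coeff_zero] at h6
  refine Eq.trans ?_ h6
  rw [Finset.sum_product, Finset.sum_product]
  simp only [Finset.mul_sum, mul_assoc]

theorem CoeffEquation.weight_le {A : ℕ → ℕ → ℂ} (hA : CoeffEquation A) {n d N : ℕ}
    (hn : ∀ i j, A i j ≠ 0 → i ≤ n) (hN : ∀ i j, A i j ≠ 0 → j ≤ N)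
    (hd : ∀ j, A n j ≠ 0 → j ≤ d) (hnd : A n d ≠ 0) (i j : ℕ) (hij : A i j ≠ 0) :
    i + 3 * j ≤ n + 3 * d := by
  by_contra hlt
  obtain ⟨i, ⟨j', hj', hw'⟩, hi⟩ := exists_greatest_of_bound
    (p := fun i => ∃ j, A i j ≠ 0 ∧ n + 3 * d < i + 3 * j) (N := n)
    ⟨i, j, hij, not_le.mp hlt⟩ (fun i ⟨j, h, _⟩ => hn i j h)
  obtain ⟨j, ⟨hj, hw⟩, hmax⟩ := exists_greatest_of_bound
    (p := fun j => A i j ≠ 0 ∧ n + 3 * d < i + 3 * j) (N := N)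
    ⟨j', hj', hw'⟩ (fun j h => hN i j h.1)
  have hin := hn i j hj
  have hne : i ≠ n := by
    rintro rfl
    have := hd j hj
    omega
  have key : ∀ a b k l, A a b ≠ 0 → A k l ≠ 0 → n + 3 * d < a + 3 * b → a + k = n + i →
      b + l = d + j → a = i ∧ b = j ∧ k = n ∧ l = d := by
    intro a b k l h1 h2 h3 h4 h5
    have h6 := hi a ⟨b, h1, h3⟩
    have h7 := hn k l h2
    obtain rfl : a = i := by omega
    obtain rfl : k = n := by omega
    have h8 := hmax b ⟨h1, h3⟩
    have h9 := hd l h2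
    omega
  obtain ⟨q, hq⟩ : ∃ q, d + j = q + 1 := ⟨d + j - 1, by omega⟩
  have e := hA (n + i) q
  rw [Finset.sum_eq_add ((n, i), (d, j)) ((i, n), (j, d))
    (by simp only [ne_eq, Prod.mk.injEq]; omega)
    (by
      rintro ⟨⟨a, k⟩, ⟨b, l⟩⟩ hm hne'
      simp only [Finset.mem_product, Finset.HasAntidiagonal.mem_antidiagonal, ne_eq,
        Prod.mk.injEq] at hm hne'
      by_contra hc
      have h1 : A a b ≠ 0 := fun h => hc (by simp [h])
      have h2 : A k l ≠ 0 := fun h => hc (by simp [h])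
      rcases lt_or_ge (n + 3 * d) (a + 3 * b) with h3 | h3
      · have := key a b k l h1 h2 h3 (by omega) (by omega)
        omega
      · have := key k l a b h2 h1 (by omega) (by omega) (by omega)
        omega)
    (fun h => absurd (mem_antidiagonal_product (by omega) (by omega)) h)
    (fun h => absurd (mem_antidiagonal_product (by omega) (by omega)) h),
    Finset.sum_eq_zero (by
      rintro ⟨⟨a, k⟩, ⟨b, l⟩⟩ hm
      simp only [Finset.mem_product, Finset.HasAntidiagonal.mem_antidiagonal] at hm
      by_contra hc
      have h1 : A a b ≠ 0 := fun h => hc (by simp [h])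
      have h2 : A k l ≠ 0 := fun h => hc (by simp [h])
      have h4 := hn a b h1
      have h5 := hn k l h2
      rcases lt_or_ge (n + 3 * d) (a + 3 * b) with h3 | h3
      · have := hi a ⟨b, h1, h3⟩
        omega
      · have := hi k ⟨l, h2, by omega⟩
        omega)] at e
  have e' : ((n : ℂ) - i) * (d - j) * (A n d * A i j) = 0 := by linear_combination e
  have h1 : (n : ℂ) - i ≠ 0 := sub_ne_zero.mpr (by exact_mod_cast hne.symm)
  have h2 : (d : ℂ) - j ≠ 0 := sub_ne_zero.mpr (by norm_cast; omega)
  exact mul_ne_zero (mul_ne_zero h1 h2) (mul_ne_zero hnd hj) e'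

theorem CoeffEquation.degree_le_four {A : ℕ → ℕ → ℂ} (hA : CoeffEquation A) {n d : ℕ}
    (hw : ∀ i j, A i j ≠ 0 → i + 3 * j ≤ n + 3 * d) (hnd : A n d ≠ 0) : n ≤ 4 := by
  have line : ∀ a b k l, A a b * A k l ≠ 0 → a + k + 3 * (b + l) = 2 * (n + 3 * d) →
      a + 3 * b = n + 3 * d ∧ k + 3 * l = n + 3 * d := by
    intro a b k l h h'
    have h1 := hw a b (left_ne_zero_of_mul h)
    have h2 := hw k l (right_ne_zero_of_mul h)
    omega
  obtain ⟨J, ⟨m, hm, hmJ⟩, hJ⟩ := exists_greatest_of_bound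
    (p := fun j => ∃ i, A i j ≠ 0 ∧ i + 3 * j = n + 3 * d) (N := n + 3 * d)
    ⟨d, n, hnd, rfl⟩ (fun i ⟨j, _, _⟩ => by omega)
  have hm1 : m ≤ 1 := by
    by_contra hm2
    obtain ⟨P, hP⟩ : ∃ P, P + 3 = 2 * m := ⟨2 * m - 3, by omega⟩
    have e := hA P (2 * J)
    rw [Finset.sum_eq_zero (by
        rintro ⟨⟨a, k⟩, ⟨b, l⟩⟩ hx
        simp only [Finset.mem_product, Finset.HasAntidiagonal.mem_antidiagonal] at hx
        by_contra hc
        have hne := right_ne_zero_of_mul hc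
        obtain ⟨h1, h2⟩ := line a b k l hne (by omega)
        have h3 := hJ b ⟨a, left_ne_zero_of_mul hne, h1⟩
        have h4 := hJ l ⟨k, right_ne_zero_of_mul hne, h2⟩
        omega),
      Finset.sum_eq_single ((m, m), (J, J)) (by
        rintro ⟨⟨a, k⟩, ⟨b, l⟩⟩ hx hne'
        simp only [Finset.mem_product, Finset.HasAntidiagonal.mem_antidiagonal, ne_eq,
          Prod.mk.injEq] at hx hne'
        by_contra hc
        have hne := right_ne_zero_of_mul hc
        obtain ⟨h1, h2⟩ := line a b k l hne (by omega)
        have h3 := hJ b ⟨a, left_ne_zero_of_mul hne, h1⟩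
        have h4 := hJ l ⟨k, right_ne_zero_of_mul hne, h2⟩
        omega)
      (fun h => absurd (mem_antidiagonal_product (by omega) (by omega)) h)] at e
    have h1 : (m : ℂ) ≠ 0 := by norm_cast; omega
    have h2 : (m : ℂ) - 1 ≠ 0 := sub_ne_zero.mpr (by norm_cast; omega)
    simp [h1, h2, hm] at e
  have hmβ : (m : ℂ) * (m - 1) = 0 := by interval_cases m <;> simp
  by_contra hn4
  obtain ⟨K, ⟨⟨r, hr, hrK⟩, hKJ⟩, hK⟩ := exists_greatest_of_bound
    (p := fun j => (∃ i, A i j ≠ 0 ∧ i + 3 * j = n + 3 * d) ∧ j < J) (N := J)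
    ⟨d, ⟨n, hnd, rfl⟩, by omega⟩ (fun j h => h.2.le)
  have top : ∀ a b, A a b ≠ 0 → a + 3 * b = n + 3 * d → (a = m ∧ b = J) ∨ b ≤ K := by
    intro a b h1 h2
    have h3 := hJ b ⟨a, h1, h2⟩
    rcases h3.lt_or_eq with h4 | h4
    · exact Or.inr (hK b ⟨⟨a, h1, h2⟩, h4⟩)
    · left; omega
  -- The two extreme monomials are adjacent, and their coefficients have a prescribed ratio.
  have hratio : J = K + 1 ∧ A m J = ((r : ℂ) * (r - 1)) ^ 2 * A r K := by
    obtain ⟨q, hq⟩ : ∃ q, J + K = q + 1 := ⟨J + K - 1, by omega⟩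
    have e := hA (m + r) q
    rw [Finset.sum_eq_add ((m, r), (J, K)) ((r, m), (K, J))
      (by simp only [ne_eq, Prod.mk.injEq]; omega)
      (by
        rintro ⟨⟨a, k⟩, ⟨b, l⟩⟩ hx hne'
        simp only [Finset.mem_product, Finset.HasAntidiagonal.mem_antidiagonal, ne_eq,
          Prod.mk.injEq] at hx hne'
        by_contra hc
        have hne := right_ne_zero_of_mul hc
        obtain ⟨h1, h2⟩ := line a b k l hne (by omega)
        have h3 := top a b (left_ne_zero_of_mul hne) h1
        have h4 := top k l (right_ne_zero_of_mul hne) h2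
        omega)
      (fun h => absurd (mem_antidiagonal_product (by omega) (by omega)) h)
      (fun h => absurd (mem_antidiagonal_product (by omega) (by omega)) h)] at e
    have second : ∀ a k b l, a + k = m + r + 3 → b + l = q →
        ((a : ℂ) * (a - 1)) * (k * (k - 1)) * (A a b * A k l) ≠ 0 →
        a + 3 * b = n + 3 * d ∧ k + 3 * l = n + 3 * d ∧ b ≤ K ∧ l ≤ K := by
      intro a k b l hx1 hx2 hc
      have hne := right_ne_zero_of_mul hc
      obtain ⟨h1, h2⟩ := line a b k l hne (by omega)
      refine ⟨h1, h2, ?_, ?_⟩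
      · rcases top a b (left_ne_zero_of_mul hne) h1 with ⟨rfl, -⟩ | h
        · simp [hmβ] at hc
        · exact h
      · rcases top k l (right_ne_zero_of_mul hne) h2 with ⟨rfl, -⟩ | h
        · simp [hmβ] at hc
        · exact h
    have hJK : (J : ℂ) - K ≠ 0 := sub_ne_zero.mpr (by norm_cast; omega)
    have hrm : (r : ℂ) = m + 3 * (J - K) := by
      have : r + 3 * K = m + 3 * J := by omega
      have : (r : ℂ) + 3 * K = m + 3 * J := by exact_mod_cast this
      linear_combination this
    by_cases hadj : J = K + 1
    · refine ⟨hadj, ?_⟩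
      rw [Finset.sum_eq_single ((r, r), (K, K)) (by
          rintro ⟨⟨a, k⟩, ⟨b, l⟩⟩ hx hne'
          simp only [Finset.mem_product, Finset.HasAntidiagonal.mem_antidiagonal, ne_eq,
            Prod.mk.injEq] at hx hne'
          by_contra hc
          have := second a k b l hx.1 hx.2 hc
          omega)
        (fun h => absurd (mem_antidiagonal_product (by omega) (by omega)) h)] at e
      have hJ1 : (J : ℂ) = K + 1 := by exact_mod_cast hadj
      rw [hJ1] at e hrm
      have e' : (3 * A r K) * (A m J - ((r : ℂ) * (r - 1)) ^ 2 * A r K) = 0 := by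
        have hrm' : (r : ℂ) = m + 3 := by linear_combination hrm
        rw [hrm'] at e ⊢
        linear_combination -e
      exact sub_eq_zero.mp ((mul_eq_zero.mp e').resolve_left
        (mul_ne_zero three_ne_zero hr))
    · exfalso
      rw [Finset.sum_eq_zero (by
          rintro ⟨⟨a, k⟩, ⟨b, l⟩⟩ hx
          simp only [Finset.mem_product, Finset.HasAntidiagonal.mem_antidiagonal] at hx
          by_contra hc
          have := second a k b l hx.1 hx.2 hc
          omega)] at e
      have e' : ((J : ℂ) - K) ^ 2 * (A m J * A r K) = 0 := by
        rw [hrm] at e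
        linear_combination (-1 / 3) * e
      exact mul_ne_zero (pow_ne_zero 2 hJK) (mul_ne_zero hm hr) e'
  obtain ⟨rfl, hratio⟩ := hratio
  obtain rfl : r = m + 3 := by omega
  obtain ⟨L, ⟨⟨s, hs, hsL⟩, hLK⟩, hL⟩ := exists_greatest_of_bound
    (p := fun j => (∃ i, A i j ≠ 0 ∧ i + 3 * j = n + 3 * d) ∧ j < K) (N := K)
    ⟨d, ⟨n, hnd, rfl⟩, by omega⟩ (fun j h => h.2.le)
  have top' : ∀ a b, A a b ≠ 0 → a + 3 * b = n + 3 * d →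
      (a = m ∧ b = K + 1) ∨ (a = m + 3 ∧ b = K) ∨ b ≤ L := by
    intro a b h1 h2
    rcases top a b h1 h2 with h3 | h3
    · exact Or.inl h3
    · rcases h3.lt_or_eq with h4 | h4
      · exact Or.inr (Or.inr (hL b ⟨⟨a, h1, h2⟩, h4⟩))
      · right; left; omega
  have e := hA (m + s) (K + L)
  rw [Finset.sum_eq_add ((m, s), (K + 1, L)) ((s, m), (L, K + 1))
      (by simp only [ne_eq, Prod.mk.injEq]; omega)
      (by
        rintro ⟨⟨a, k⟩, ⟨b, l⟩⟩ hx hne'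
        simp only [Finset.mem_product, Finset.HasAntidiagonal.mem_antidiagonal, ne_eq,
          Prod.mk.injEq] at hx hne'
        by_contra hc
        have hne := right_ne_zero_of_mul hc
        have hak : a ≠ k := by
          rintro rfl
          simp at hc
        obtain ⟨h1, h2⟩ := line a b k l hne (by omega)
        have h3 := top' a b (left_ne_zero_of_mul hne) h1
        have h4 := top' k l (right_ne_zero_of_mul hne) h2
        omega)
      (fun h => absurd (mem_antidiagonal_product (by omega) (by omega)) h)
      (fun h => absurd (mem_antidiagonal_product (by omega) (by omega)) h),
    Finset.sum_eq_add ((m + 3, s), (K, L)) ((s, m + 3), (L, K))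
      (by simp only [ne_eq, Prod.mk.injEq]; omega)
      (by
        rintro ⟨⟨a, k⟩, ⟨b, l⟩⟩ hx hne'
        simp only [Finset.mem_product, Finset.HasAntidiagonal.mem_antidiagonal, ne_eq,
          Prod.mk.injEq] at hx hne'
        by_contra hc
        have hne := right_ne_zero_of_mul hc
        have ham : a ≠ m := by
          rintro rfl
          simp [hmβ] at hc
        have hkm : k ≠ m := by
          rintro rfl
          simp [hmβ] at hc
        obtain ⟨h1, h2⟩ := line a b k l hne (by omega)
        have h3 := top' a b (left_ne_zero_of_mul hne) h1
        have h4 := top' k l (right_ne_zero_of_mul hne) h2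
        omega)
      (fun h => absurd (mem_antidiagonal_product (by omega) (by omega)) h)
      (fun h => absurd (mem_antidiagonal_product (by omega) (by omega)) h)] at e
  obtain ⟨k, rfl⟩ : ∃ k, K = L + k + 1 := ⟨K - L - 1, by omega⟩
  obtain rfl : s = m + 3 * (k + 2) := by omega
  rw [hratio] at e
  have hc : A (m + 3) (L + k + 1) * A (m + 3 * (k + 2)) L ≠ 0 := mul_ne_zero hr hs
  have e' : (A (m + 3) (L + k + 1) * A (m + 3 * (k + 2)) L) * ((((m + 3) * (m + 2) *
      (2 * ((m + 3 * (k + 2)) * (m + 3 * (k + 2) - 1)) - (k + 2) ^ 2 * ((m + 3) * (m + 2)))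
      : ℤ)) : ℂ) = 0 := by
    push_cast
    push_cast at e
    linear_combination (1 / 3) * e
  have e'' := Int.cast_eq_zero.mp ((mul_eq_zero.mp e').resolve_left hc)
  interval_cases m <;> push_cast at e'' <;> nlinarith

/-- No polynomial of `x`-degree `≥ 5` solves the generalized bilinear KdV-type equation:
every solution `f` has `deg_x f ≤ 4`. -/
theorem degree_at_most_four (f : Polynomial (Polynomial ℂ)) (hf : Tkdv f = 0) :
    f.natDegree ≤ 4 := by
  rcases eq_or_ne f 0 with rfl | h0
  · simp
  have hA := coeffEquation_of_Tkdv_eq_zero hf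
  have hnd : (f.coeff f.natDegree).coeff (f.coeff f.natDegree).natDegree ≠ 0 := by
    simpa using h0
  refine hA.degree_le_four (d := (f.coeff f.natDegree).natDegree) (hA.weight_le
    (N := f.support.sup fun i => (f.coeff i).natDegree) ?_ ?_ ?_ hnd) hnd
  · intro i j h
    exact le_natDegree_of_ne_zero fun h' => h (by simp [h'])
  · intro i j h
    refine (le_natDegree_of_ne_zero h).trans
      (Finset.le_sup (f := fun i => (f.coeff i).natDegree) ?_)
    exact mem_support_iff.mpr fun h' => h (by simp [h'])
  · exact fun j h => le_natDegree_of_ne_zero h
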